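/- Let K be a field and N ≥ 3. Set α₁ = I − ∑_{k=2}^{N−1} α_k. Then the family {α_k}_{1 ≤ k ≤ N−1} is a Pierce decomposition in M_N(K[x]): ∑_{k=1}^{N−1} α_k = I and α_i α_j = δ_{ij} α_i for all 1 ≤ i, j ≤ N−1 (in particular each α_k is idempotent and distinct α_i, α_j are orthogonal); moreover every α_k belongs to Γ. -/

import Mathlib

open Polynomial Finset

/-- The map P_k(θ) = (k+1)·θ_{k+1} − ∑_{j=k+2}^{k+D} (−1)^{j−k} [θ_j, S^{j−k−1}],
acting on matrix polynomials θ ∈ M_N(K[x]) (encoded as polynomials with N×N matrix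
coefficients), where S ∈ M_N(K) and [A,B] = AB − BA. -/
noncomputable def Pk {K : Type*} [Field K] {N : ℕ} (D : ℕ) (S : Matrix (Fin N) (Fin N) K)
    (k : ℕ) (θ : Polynomial (Matrix (Fin N) (Fin N) K)) : Matrix (Fin N) (Fin N) K :=
  (k + 1) • θ.coeff (k + 1) -
    ∑ j ∈ Finset.Icc (k + 2) (k + D),
      ((-1 : K) ^ (j - k)) • (θ.coeff j * S ^ (j - k - 1) - S ^ (j - k - 1) * θ.coeff j)

/-- The set Γ of matrix polynomials θ ∈ M_N(K[x]) satisfying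
(i) P_0(x·θ) = P_0(θ(0)·x), (ii) P_0(x^j·θ) = 0 for all j ≥ 2, and
(iii) ∑_{k=0}^{q} (−1)^k S^{k+D−q−1} P_k(θ) = 0 for every 0 ≤ q ≤ D−1. -/
noncomputable def GammaSet {K : Type*} [Field K] {N : ℕ} (D : ℕ)
    (S : Matrix (Fin N) (Fin N) K) : Set (Polynomial (Matrix (Fin N) (Fin N) K)) :=
  {θ | Pk D S 0 (X * θ) = Pk D S 0 (C (θ.coeff 0) * X) ∧
       (∀ j, 2 ≤ j → Pk D S 0 (X ^ j * θ) = 0) ∧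
       (∀ q, q < D →
         ∑ k ∈ Finset.range (q + 1),
           ((-1 : K) ^ k) • (S ^ (k + D - q - 1) * Pk D S k θ) = 0)}

/-- The 1-based matrix unit e_{r,s} ∈ M_N(K), with the convention that it is 0 when
r or s lies outside {1,…,N}. -/
def eu (K : Type*) [Field K] (N r s : ℕ) : Matrix (Fin N) (Fin N) K :=
  Matrix.of fun i j => if (i : ℕ) + 1 = r ∧ (j : ℕ) + 1 = s then 1 else 0

/-- The N×N shift matrix S_N = ∑_{s=1}^{N−1} e_{s,s+1}. -/
noncomputable def SN (K : Type*) [Field K] (N : ℕ) : Matrix (Fin N) (Fin N) K :=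
  ∑ s ∈ Finset.Icc 1 (N - 1), eu K N s (s + 1)

/-- The coefficient a_{kj} = (−1)^{j+1}(δ_{j,k−1} e_{k,1} + δ_{j,N−k} e_{N,k})
+ (−1)^j δ_{j,N−1} e_{N,1}. -/
noncomputable def acoef (K : Type*) [Field K] (N k j : ℕ) : Matrix (Fin N) (Fin N) K :=
  ((-1 : K) ^ (j + 1)) •
      ((if j = k - 1 then eu K N k 1 else 0) + (if j = N - k then eu K N N k else 0)) +
    ((-1 : K) ^ j) • (if j = N - 1 then eu K N N 1 else 0)

/-- The matrix polynomial α_k(x) = e_{k,k} + ∑_{j=1}^{N−1} a_{kj} x^j, for 2 ≤ k ≤ N−1. -/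
noncomputable def alphaPoly (K : Type*) [Field K] (N k : ℕ) :
    Polynomial (Matrix (Fin N) (Fin N) K) :=
  C (eu K N k k) + ∑ j ∈ Finset.Icc 1 (N - 1), C (acoef K N k j) * X ^ j

/-- α_k for 1 ≤ k ≤ N−1: for k = 1 it is I − ∑_{k=2}^{N−1} α_k, otherwise α_k as above. -/
noncomputable def alphaFull (K : Type*) [Field K] (N k : ℕ) :
    Polynomial (Matrix (Fin N) (Fin N) K) :=
  if k = 1 then 1 - ∑ j ∈ Finset.Icc 2 (N - 1), alphaPoly K N j else alphaPoly K N k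

theorem eu_eq_zero_of_row {K : Type*} [Field K] {N r : ℕ} (s : ℕ) (h : r = 0 ∨ N < r) :
    eu K N r s = 0 := by
  ext i j
  have := i.isLt
  simp only [eu, Matrix.of_apply, Matrix.zero_apply, ite_eq_right_iff]
  omega

theorem eu_eq_zero_of_col {K : Type*} [Field K] {N s : ℕ} (r : ℕ) (h : s = 0 ∨ N < s) :
    eu K N r s = 0 := by
  ext i j
  have := j.isLt
  simp only [eu, Matrix.of_apply, Matrix.zero_apply, ite_eq_right_iff]
  omega

theorem eu_mul_eu_same {K : Type*} [Field K] {N s : ℕ} (r t : ℕ) (h1 : 1 ≤ s) (h2 : s ≤ N) :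
    eu K N r s * eu K N s t = eu K N r t := by
  ext i j
  rw [Matrix.mul_apply, Finset.sum_eq_single (⟨s - 1, by omega⟩ : Fin N)]
  · have : s - 1 + 1 = s := by omega
    simp only [eu, Matrix.of_apply, this, ite_and, mul_ite, mul_one, mul_zero]
    split_ifs <;> rfl
  · intro b _ hb
    have : (b : ℕ) + 1 ≠ s := fun h => hb (Fin.ext (by simp; omega))
    simp [eu, this]
  · simp

theorem eu_mul_eu_of_ne {K : Type*} [Field K] {N s s' : ℕ} (r t : ℕ) (h : s ≠ s') :
    eu K N r s * eu K N s' t = 0 := by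
  ext i j
  rw [Matrix.mul_apply]
  refine Finset.sum_eq_zero fun b _ => ?_
  simp only [eu, Matrix.of_apply, mul_ite, mul_one, mul_zero, ite_eq_right_iff]
  intro h1 h2
  omega

theorem eu_mul_SN {K : Type*} [Field K] {N s : ℕ} (r : ℕ) (hs : 1 ≤ s) :
    eu K N r s * SN K N = eu K N r (s + 1) := by
  rw [SN, Finset.mul_sum]
  by_cases h : s ≤ N - 1
  · rw [Finset.sum_eq_single s, eu_mul_eu_same _ _ hs (by omega)]
    · exact fun b _ hb => eu_mul_eu_of_ne _ _ hb.symm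
    · simp only [Finset.mem_Icc]; omega
  · rw [eu_eq_zero_of_col _ (by omega : s + 1 = 0 ∨ N < s + 1)]
    refine Finset.sum_eq_zero fun b hb => eu_mul_eu_of_ne _ _ ?_
    simp only [Finset.mem_Icc] at hb; omega

theorem SN_mul_eu {K : Type*} [Field K] {N r : ℕ} (s : ℕ) (hr : r ≤ N) :
    SN K N * eu K N r s = eu K N (r - 1) s := by
  rw [SN, Finset.sum_mul]
  by_cases h : 2 ≤ r
  · have h1 : r - 1 + 1 = r := by omega
    rw [Finset.sum_eq_single (r - 1), h1, eu_mul_eu_same _ _ (by omega) hr]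
    · exact fun b _ hb => eu_mul_eu_of_ne _ _ (by omega)
    · simp only [Finset.mem_Icc]; omega
  · rw [eu_eq_zero_of_row _ (by omega : r - 1 = 0 ∨ N < r - 1)]
    refine Finset.sum_eq_zero fun b hb => eu_mul_eu_of_ne _ _ ?_
    simp only [Finset.mem_Icc] at hb; omega

theorem eu_mul_SN_pow {K : Type*} [Field K] {N s : ℕ} (r c : ℕ) (hs : 1 ≤ s) :
    eu K N r s * SN K N ^ c = eu K N r (s + c) := by
  induction c with
  | zero => simp
  | succ c ih => rw [pow_succ, ← mul_assoc, ih, eu_mul_SN _ (by omega), add_assoc]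

theorem SN_pow_mul_eu {K : Type*} [Field K] {N r : ℕ} (s c : ℕ) (hr : r ≤ N) :
    SN K N ^ c * eu K N r s = eu K N (r - c) s := by
  induction c with
  | zero => simp
  | succ c ih => rw [pow_succ', mul_assoc, ih, SN_mul_eu _ (by omega), Nat.sub_sub]

theorem sum_eu_diag (K : Type*) [Field K] (N : ℕ) : ∑ r ∈ Finset.Icc 1 N, eu K N r r = 1 := by
  ext i j
  rw [Matrix.sum_apply, Finset.sum_eq_single ((i : ℕ) + 1)]
  · simp [eu, Matrix.one_apply, Fin.ext_iff, eq_comm]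
  · intro b _ hb
    simp [eu, hb.symm]
  · have := i.isLt
    simp only [Finset.mem_Icc]; omega

theorem SN_pow_eq_zero (K : Type*) [Field K] {N c : ℕ} (h : N ≤ c) : SN K N ^ c = 0 := by
  rw [← mul_one (SN K N ^ c), ← sum_eu_diag, Finset.mul_sum]
  refine Finset.sum_eq_zero fun r hr => ?_
  simp only [Finset.mem_Icc] at hr
  rw [SN_pow_mul_eu _ _ hr.2, eu_eq_zero_of_row _ (by omega)]

section PkMonomial

variable {K : Type*} [Field K] {N : ℕ} (D : ℕ) (S : Matrix (Fin N) (Fin N) K)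

theorem Pk_add (k : ℕ) (θ η : Polynomial (Matrix (Fin N) (Fin N) K)) :
    Pk D S k (θ + η) = Pk D S k θ + Pk D S k η := by
  have h : ∀ j, ((-1 : K) ^ (j - k)) • ((θ + η).coeff j * S ^ (j - k - 1) -
      S ^ (j - k - 1) * (θ + η).coeff j) =
      ((-1 : K) ^ (j - k)) • (θ.coeff j * S ^ (j - k - 1) - S ^ (j - k - 1) * θ.coeff j) +
      ((-1 : K) ^ (j - k)) • (η.coeff j * S ^ (j - k - 1) - S ^ (j - k - 1) * η.coeff j) := by
    intro j
    rw [← smul_add, coeff_add, add_mul, mul_add]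
    congr 1
    abel
  rw [Pk, Finset.sum_congr rfl fun j _ => h j, Finset.sum_add_distrib, coeff_add, smul_add, Pk, Pk]
  abel

/-- `Pk` as a homomorphism of additive groups. -/
noncomputable def PkHom (k : ℕ) :
    Polynomial (Matrix (Fin N) (Fin N) K) →+ Matrix (Fin N) (Fin N) K :=
  AddMonoidHom.mk' (Pk D S k) (Pk_add D S k)

theorem Pk_monomial_of_le {j k : ℕ} (h : j ≤ k) (A : Matrix (Fin N) (Fin N) K) :
    Pk D S k (monomial j A) = 0 := by
  rw [Pk, coeff_monomial, if_neg (by omega), smul_zero, zero_sub, neg_eq_zero]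
  refine Finset.sum_eq_zero fun i hi => ?_
  simp only [Finset.mem_Icc] at hi
  rw [coeff_monomial, if_neg (by omega)]
  simp

theorem Pk_monomial_succ (k : ℕ) (A : Matrix (Fin N) (Fin N) K) :
    Pk D S k (monomial (k + 1) A) = (k + 1) • A := by
  rw [Pk, coeff_monomial, if_pos rfl, sub_eq_self]
  refine Finset.sum_eq_zero fun i hi => ?_
  simp only [Finset.mem_Icc] at hi
  rw [coeff_monomial, if_neg (by omega)]
  simp

theorem Pk_monomial_add_two (hS : S ^ D = 0) (k i : ℕ) (A : Matrix (Fin N) (Fin N) K) :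
    Pk D S k (monomial (k + i + 2) A) =
      -((-1 : K) ^ i • (A * S ^ (i + 1) - S ^ (i + 1) * A)) := by
  have h1 : k + i + 2 - k = i + 2 := by omega
  rw [Pk, coeff_monomial, if_neg (by omega), smul_zero, zero_sub,
    Finset.sum_eq_single (k + i + 2)]
  · rw [coeff_monomial, if_pos rfl, h1, pow_add]
    simp
  · intro b _ hb
    rw [coeff_monomial, if_neg hb.symm]
    simp
  · intro h
    simp only [Finset.mem_Icc] at h
    rw [h1, pow_eq_zero_of_le (by omega : D ≤ i + 2 - 1) hS]
    simp

/-- The defect in condition (i) of `GammaSet`. -/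
noncomputable def shiftDefect :
    Polynomial (Matrix (Fin N) (Fin N) K) →+ Matrix (Fin N) (Fin N) K :=
  (PkHom D S 0).comp (AddMonoidHom.mulLeft X) -
    (PkHom D S 0).comp ((AddMonoidHom.mulRight X).comp
      (C.toAddMonoidHom.comp (lcoeff (Matrix (Fin N) (Fin N) K) 0).toAddMonoidHom))

/-- The left-hand side of condition (ii) of `GammaSet`. -/
noncomputable def powDefect (m : ℕ) :
    Polynomial (Matrix (Fin N) (Fin N) K) →+ Matrix (Fin N) (Fin N) K :=
  (PkHom D S 0).comp (AddMonoidHom.mulLeft (X ^ m))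

/-- The left-hand side of condition (iii) of `GammaSet`. -/
noncomputable def alternatingDefect (q : ℕ) :
    Polynomial (Matrix (Fin N) (Fin N) K) →+ Matrix (Fin N) (Fin N) K :=
  ∑ k ∈ Finset.range (q + 1), (DistribSMul.toAddMonoidHom _ ((-1 : K) ^ k)).comp
    ((AddMonoidHom.mulLeft (S ^ (k + D - q - 1))).comp (PkHom D S k))

theorem shiftDefect_apply (θ : Polynomial (Matrix (Fin N) (Fin N) K)) :
    shiftDefect D S θ = Pk D S 0 (X * θ) - Pk D S 0 (C (θ.coeff 0) * X) := rfl

theorem powDefect_apply (m : ℕ) (θ : Polynomial (Matrix (Fin N) (Fin N) K)) :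
    powDefect D S m θ = Pk D S 0 (X ^ m * θ) := rfl

theorem alternatingDefect_apply (q : ℕ) (θ : Polynomial (Matrix (Fin N) (Fin N) K)) :
    alternatingDefect D S q θ = ∑ k ∈ Finset.range (q + 1),
      ((-1 : K) ^ k) • (S ^ (k + D - q - 1) * Pk D S k θ) := by
  simp only [alternatingDefect, AddMonoidHom.finsetSum_apply]
  rfl

theorem mem_GammaSet_iff (θ : Polynomial (Matrix (Fin N) (Fin N) K)) :
    θ ∈ GammaSet D S ↔ shiftDefect D S θ = 0 ∧ (∀ m, 2 ≤ m → powDefect D S m θ = 0) ∧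
      ∀ q, q < D → alternatingDefect D S q θ = 0 := by
  simp only [shiftDefect_apply, powDefect_apply, alternatingDefect_apply, sub_eq_zero]
  rfl

theorem shiftDefect_monomial_zero (A : Matrix (Fin N) (Fin N) K) :
    shiftDefect D S (monomial 0 A) = 0 := by
  rw [shiftDefect_apply, sub_eq_zero, coeff_monomial, if_pos rfl, monomial_zero_left, X_mul_C]

theorem shiftDefect_monomial_succ (hS : S ^ D = 0) (i : ℕ) (A : Matrix (Fin N) (Fin N) K) :
    shiftDefect D S (monomial (i + 1) A) =
      -((-1 : K) ^ i • (A * S ^ (i + 1) - S ^ (i + 1) * A)) := by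
  have h0 : Pk D S 0 (0 : Polynomial (Matrix (Fin N) (Fin N) K)) = 0 := map_zero (PkHom D S 0)
  have h := Pk_monomial_add_two D S hS 0 i A
  rw [zero_add] at h
  rw [shiftDefect_apply, coeff_monomial, if_neg (by omega), C_0, zero_mul, h0, sub_zero,
    X_mul_monomial, h]

theorem powDefect_monomial (hS : S ^ D = 0) (m i : ℕ) (A : Matrix (Fin N) (Fin N) K) :
    powDefect D S (m + 2) (monomial i A) =
      -((-1 : K) ^ (i + m) • (A * S ^ (i + m + 1) - S ^ (i + m + 1) * A)) := by
  have h := Pk_monomial_add_two D S hS 0 (i + m) A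
  rw [zero_add] at h
  rw [powDefect_apply, X_pow_mul_monomial, ← h, add_assoc]

theorem alternatingDefect_monomial_zero (q : ℕ) (A : Matrix (Fin N) (Fin N) K) :
    alternatingDefect D S q (monomial 0 A) = 0 := by
  rw [alternatingDefect_apply]
  exact Finset.sum_eq_zero fun k _ => by rw [Pk_monomial_of_le D S (Nat.zero_le k)]; simp

theorem alternatingDefect_monomial_succ (hS : S ^ D = 0) {q : ℕ} (hq : q < D) (m : ℕ)
    (A : Matrix (Fin N) (Fin N) K) :
    alternatingDefect D S q (monomial (m + 1) A) =
      (-1 : K) ^ m • ∑ k ∈ Finset.range (m + 1), S ^ (k + (D - 1 - q)) * A * S ^ (m - k) := by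
  have hext : alternatingDefect D S q (monomial (m + 1) A) = ∑ k ∈ Finset.range (m + 1),
      ((-1 : K) ^ k) • (S ^ (k + (D - 1 - q)) * Pk D S k (monomial (m + 1) A)) := by
    have hexp : ∀ k, k + D - q - 1 = k + (D - 1 - q) := fun k => by omega
    simp only [alternatingDefect_apply, hexp]
    rcases le_total q m with h | h
    · refine Finset.sum_subset (Finset.range_mono (by omega)) fun k _ hk => ?_
      simp only [Finset.mem_range] at hk
      rw [pow_eq_zero_of_le (by omega : D ≤ k + (D - 1 - q)) hS]
      simp
    · refine (Finset.sum_subset (Finset.range_mono (by omega)) fun k _ hk => ?_).symm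
      simp only [Finset.mem_range] at hk
      rw [Pk_monomial_of_le D S (by omega)]
      simp
  have hterm : ∀ k ∈ Finset.range m,
      ((-1 : K) ^ k) • (S ^ (k + (D - 1 - q)) * Pk D S k (monomial (m + 1) A)) =
      (-1 : K) ^ m • (S ^ (k + (D - 1 - q)) * A * S ^ (m - k)) -
        (-1 : K) ^ m • (S ^ (m + (D - 1 - q)) * A) := by
    intro k hk
    simp only [Finset.mem_range] at hk
    obtain ⟨i, rfl⟩ : ∃ i, m = k + i + 1 := ⟨m - k - 1, by omega⟩
    have h1 : k + i + 1 - k = i + 1 := by omega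
    have h2 : k + i + 1 + (D - 1 - q) = k + (D - 1 - q) + (i + 1) := by omega
    have h3 : (-1 : K) ^ (k + i + 1) = -((-1) ^ k * (-1) ^ i) := by ring
    rw [Pk_monomial_add_two D S hS k i A, h1, h2, h3, pow_add S _ (i + 1), ← smul_sub, mul_neg,
      mul_smul_comm, mul_sub, smul_neg, smul_smul, neg_smul]
    simp only [mul_assoc]
  rw [hext, Finset.sum_range_succ, Finset.sum_congr rfl hterm, Pk_monomial_succ,
    Finset.sum_sub_distrib, ← Finset.smul_sum, Finset.sum_range_succ, Finset.sum_const,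
    Finset.card_range, Nat.sub_self, pow_zero, mul_one, mul_smul_comm, smul_comm _ (m + 1),
    succ_nsmul, smul_add]
  abel

end PkMonomial

/-- The homogeneous matrix unit `(-x)^(r - s) e_{r,s}`. -/
noncomputable def homUnit (K : Type*) [Field K] (N r s : ℕ) :
    Polynomial (Matrix (Fin N) (Fin N) K) :=
  monomial (r - s) ((-1 : K) ^ (r - s) • eu K N r s)

theorem homUnit_mul_same {K : Type*} [Field K] {N r s t : ℕ} (hN : s ≤ N) (h1 : 1 ≤ s)
    (hrs : s ≤ r) (hst : t ≤ s) :
    homUnit K N r s * homUnit K N s t = homUnit K N r t := by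
  have h : r - t = (r - s) + (s - t) := by omega
  rw [homUnit, homUnit, homUnit, monomial_mul_monomial, smul_mul_smul_comm,
    eu_mul_eu_same _ _ h1 hN, h, pow_add]

theorem homUnit_mul_of_ne {K : Type*} [Field K] {N s s' : ℕ} (r t : ℕ) (h : s ≠ s') :
    homUnit K N r s * homUnit K N s' t = 0 := by
  rw [homUnit, homUnit, monomial_mul_monomial, smul_mul_smul_comm, eu_mul_eu_of_ne _ _ h,
    smul_zero, monomial_zero_right]

theorem alphaPoly_eq_homUnit (K : Type*) [Field K] {N k : ℕ} (h2 : 2 ≤ k) (hk : k ≤ N - 1) :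
    alphaPoly K N k =
      homUnit K N k k - homUnit K N k 1 - homUnit K N N k + homUnit K N N 1 := by
  have key : ∀ j ∈ Finset.Icc 1 (N - 1), C (acoef K N k j) * X ^ j =
      (if j = k - 1 then -homUnit K N k 1 else 0) +
      (if j = N - k then -homUnit K N N k else 0) +
      (if j = N - 1 then homUnit K N N 1 else 0) := by
    intro j _
    have hlin : ∀ A B : Matrix (Fin N) (Fin N) K,
        monomial j (A + B) = monomial j A + monomial j B := fun A B => map_add _ A B
    rw [C_mul_X_pow_eq_monomial, acoef, smul_add, hlin, hlin]
    congr 1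
    · congr 1
      · split_ifs with h
        · subst h
          rw [homUnit, pow_succ, mul_neg_one, neg_smul, map_neg]
        · simp
      · split_ifs with h
        · subst h
          rw [homUnit, pow_succ, mul_neg_one, neg_smul, map_neg]
        · simp
    · split_ifs with h
      · subst h
        rw [homUnit]
      · simp
  have m1 : k - 1 ∈ Finset.Icc 1 (N - 1) := by simp only [Finset.mem_Icc]; omega
  have m2 : N - k ∈ Finset.Icc 1 (N - 1) := by simp only [Finset.mem_Icc]; omega
  have m3 : N - 1 ∈ Finset.Icc 1 (N - 1) := by simp only [Finset.mem_Icc]; omega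
  have h0 : homUnit K N k k = C (eu K N k k) := by simp [homUnit]
  rw [alphaPoly, Finset.sum_congr rfl key, Finset.sum_add_distrib, Finset.sum_add_distrib,
    Finset.sum_ite_eq', Finset.sum_ite_eq', Finset.sum_ite_eq', if_pos m1, if_pos m2, if_pos m3, h0]
  abel

theorem alphaPoly_mul_alphaPoly (K : Type*) [Field K] {N i j : ℕ} (hi : i ∈ Finset.Icc 2 (N - 1))
    (hj : j ∈ Finset.Icc 2 (N - 1)) :
    alphaPoly K N i * alphaPoly K N j = if i = j then alphaPoly K N i else 0 := by
  simp only [Finset.mem_Icc] at hi hj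
  rw [alphaPoly_eq_homUnit K hi.1 hi.2, alphaPoly_eq_homUnit K hj.1 hj.2]
  have hij : ∀ r, homUnit K N r i * homUnit K N N j = 0 := fun r =>
    homUnit_mul_of_ne _ _ (by omega)
  have hiN : ∀ r, homUnit K N r i * homUnit K N N 1 = 0 := fun r =>
    homUnit_mul_of_ne _ _ (by omega)
  have h1j : ∀ r t, homUnit K N r 1 * homUnit K N j t = 0 := fun r t =>
    homUnit_mul_of_ne _ _ (by omega)
  have h1N : ∀ r t, homUnit K N r 1 * homUnit K N N t = 0 := fun r t =>
    homUnit_mul_of_ne _ _ (by omega)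
  simp only [mul_add, mul_sub, add_mul, sub_mul, hij, hiN, h1j, h1N]
  split_ifs with h
  · subst h
    have hs : ∀ r t, i ≤ r → t ≤ i →
        homUnit K N r i * homUnit K N i t = homUnit K N r t := fun r t hr ht =>
      homUnit_mul_same (by omega) (by omega) hr ht
    rw [hs i i le_rfl le_rfl, hs i 1 le_rfl (by omega), hs N i (by omega) le_rfl,
      hs N 1 (by omega) (by omega)]
    abel
  · have hne : ∀ r t, homUnit K N r i * homUnit K N j t = 0 := fun r t =>
      homUnit_mul_of_ne _ _ h
    simp [hne]

/-- An additive map which is a coboundary on homogeneous matrix units kills every `α_k`. -/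
theorem map_alphaPoly_eq_zero {K G : Type*} [Field K] [AddCommGroup G] {N k : ℕ}
    (F : Polynomial (Matrix (Fin N) (Fin N) K) →+ G) (f g : ℕ → G)
    (hF : ∀ s j, 1 ≤ s → s + j ≤ N → F (homUnit K N (s + j) s) = f (s + j) - g s)
    (h2 : 2 ≤ k) (hk : k ≤ N - 1) : F (alphaPoly K N k) = 0 := by
  have hF' : ∀ r s, 1 ≤ s → s ≤ r → r ≤ N → F (homUnit K N r s) = f r - g s := by
    intro r s h1 hsr hr
    obtain ⟨j, rfl⟩ := Nat.exists_eq_add_of_le hsr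
    exact hF s j h1 hr
  rw [alphaPoly_eq_homUnit K h2 hk, map_add, map_sub, map_sub,
    hF' k k (by omega) le_rfl (by omega), hF' k 1 le_rfl (by omega) (by omega),
    hF' N k (by omega) (by omega) le_rfl, hF' N 1 le_rfl (by omega) le_rfl]
  abel

theorem neg_one_pow_mul_self (K : Type*) [Field K] (n : ℕ) : (-1 : K) ^ n * (-1) ^ n = 1 := by
  rw [← mul_pow]; simp

theorem shiftDefect_homUnit {K : Type*} [Field K] {N s j : ℕ} (hs : 1 ≤ s) (hj : s + j ≤ N) :
    shiftDefect N (SN K N) (homUnit K N (s + j) s) =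
      eu K N (s + j) (s + j) - eu K N s s := by
  rw [homUnit, Nat.add_sub_cancel_left]
  rcases j with _ | i
  · rw [shiftDefect_monomial_zero]; simp
  · rw [shiftDefect_monomial_succ _ _ (SN_pow_eq_zero K le_rfl), smul_mul_assoc, mul_smul_comm,
      eu_mul_SN_pow _ _ hs, SN_pow_mul_eu _ _ hj, Nat.add_sub_cancel, ← smul_sub, smul_smul,
      ← neg_smul, pow_succ, mul_neg_one, mul_neg, neg_neg, neg_one_pow_mul_self, one_smul]

theorem powDefect_homUnit {K : Type*} [Field K] {N s j : ℕ} (m : ℕ) (hs : 1 ≤ s)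
    (hj : s + j ≤ N) :
    powDefect N (SN K N) (m + 2) (homUnit K N (s + j) s) =
      (-(-1 : K) ^ m) • eu K N (s + j) (s + j + m + 1) -
        (-(-1 : K) ^ m) • eu K N (s - (m + 1)) s := by
  have h1 : s + j - (j + m + 1) = s - (m + 1) := by omega
  have h2 : s + (j + m + 1) = s + j + m + 1 := by omega
  rw [homUnit, Nat.add_sub_cancel_left, powDefect_monomial _ _ (SN_pow_eq_zero K le_rfl),
    smul_mul_assoc, mul_smul_comm, eu_mul_SN_pow _ _ hs, SN_pow_mul_eu _ _ hj, h1, h2,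
    ← smul_sub, smul_smul, ← smul_sub, ← neg_smul, pow_add, mul_right_comm,
    neg_one_pow_mul_self, one_mul]

theorem alternatingDefect_homUnit {K : Type*} [Field K] {N s j q : ℕ} (hs : 1 ≤ s)
    (hj : s + j ≤ N) (hq : q < N) :
    alternatingDefect N (SN K N) q (homUnit K N (s + j) s) =
      (-∑ c ∈ Finset.range (s + j), eu K N (c + 1 - (N - 1 - q)) c) -
        (-∑ c ∈ Finset.range s, eu K N (c + 1 - (N - 1 - q)) c) := by
  rw [homUnit, Nat.add_sub_cancel_left]
  rcases j with _ | m
  · rw [alternatingDefect_monomial_zero]; simp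
  · have hterm : ∀ k ∈ Finset.range (m + 1),
        SN K N ^ (k + (N - 1 - q)) * ((-1 : K) ^ (m + 1) • eu K N (s + (m + 1)) s) *
          SN K N ^ (m - k) =
        (-1 : K) ^ (m + 1) • eu K N (s + (m + 1 - 1 - k) + 1 - (N - 1 - q))
          (s + (m + 1 - 1 - k)) := by
      intro k hk
      simp only [Finset.mem_range] at hk
      have h1 : s + (m + 1) - (k + (N - 1 - q)) =
        s + (m + 1 - 1 - k) + 1 - (N - 1 - q) := by omega
      rw [mul_smul_comm, smul_mul_assoc, SN_pow_mul_eu _ _ hj, eu_mul_SN_pow _ _ hs, h1,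
        Nat.add_sub_cancel]
    rw [alternatingDefect_monomial_succ _ _ (SN_pow_eq_zero K le_rfl) hq,
      Finset.sum_congr rfl hterm,
      Finset.sum_range_reflect (fun c => (-1 : K) ^ (m + 1) •
        eu K N (s + c + 1 - (N - 1 - q)) (s + c)) (m + 1),
      ← Finset.smul_sum, smul_smul, pow_succ, mul_neg_one, mul_neg, neg_one_pow_mul_self,
      Finset.sum_range_add _ s (m + 1), neg_smul, one_smul]
    abel

theorem alphaPoly_mem_GammaSet (K : Type*) [Field K] {N k : ℕ} (h2 : 2 ≤ k) (hk : k ≤ N - 1) :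
    alphaPoly K N k ∈ GammaSet N (SN K N) := by
  refine (mem_GammaSet_iff _ _ _).2 ⟨?_, fun m hm => ?_, fun q hq => ?_⟩
  · exact map_alphaPoly_eq_zero _ (fun r => eu K N r r) (fun s => eu K N s s)
      (fun s j hs hj => shiftDefect_homUnit hs hj) h2 hk
  · obtain ⟨m, rfl⟩ := Nat.exists_eq_add_of_le' hm
    exact map_alphaPoly_eq_zero _ (fun r => (-(-1 : K) ^ m) • eu K N r (r + m + 1))
      (fun s => (-(-1 : K) ^ m) • eu K N (s - (m + 1)) s)
      (fun s j hs hj => powDefect_homUnit m hs hj) h2 hk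
  · exact map_alphaPoly_eq_zero _
      (fun r => -∑ c ∈ Finset.range r, eu K N (c + 1 - (N - 1 - q)) c)
      (fun s => -∑ c ∈ Finset.range s, eu K N (c + 1 - (N - 1 - q)) c)
      (fun s j hs hj => alternatingDefect_homUnit hs hj hq) h2 hk

theorem one_mem_GammaSet {K : Type*} [Field K] {N D : ℕ} {S : Matrix (Fin N) (Fin N) K}
    (hS : S ^ D = 0) : 1 ∈ GammaSet D S := by
  rw [← monomial_zero_one, mem_GammaSet_iff]
  refine ⟨shiftDefect_monomial_zero _ _ _, fun m hm => ?_, fun q _ =>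
    alternatingDefect_monomial_zero _ _ _ _⟩
  obtain ⟨m, rfl⟩ := Nat.exists_eq_add_of_le' hm
  rw [powDefect_monomial _ _ hS]
  simp

theorem sub_sum_mem_GammaSet {K ι : Type*} [Field K] {N D : ℕ} {S : Matrix (Fin N) (Fin N) K}
    {θ : Polynomial (Matrix (Fin N) (Fin N) K)} {s : Finset ι}
    {η : ι → Polynomial (Matrix (Fin N) (Fin N) K)} (hθ : θ ∈ GammaSet D S)
    (hη : ∀ i ∈ s, η i ∈ GammaSet D S) : θ - ∑ i ∈ s, η i ∈ GammaSet D S := by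
  simp only [mem_GammaSet_iff] at hθ hη ⊢
  refine ⟨?_, fun m hm => ?_, fun q hq => ?_⟩
  · rw [map_sub, map_sum, hθ.1, Finset.sum_eq_zero fun i hi => (hη i hi).1, sub_zero]
  · rw [map_sub, map_sum, hθ.2.1 m hm, Finset.sum_eq_zero fun i hi => (hη i hi).2.1 m hm, sub_zero]
  · rw [map_sub, map_sum, hθ.2.2 q hq, Finset.sum_eq_zero fun i hi => (hη i hi).2.2 q hq, sub_zero]

/-- For N ≥ 3, with α₁ = I − ∑_{k=2}^{N−1} α_k, the family {α_k}_{1≤k≤N−1}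
is a Pierce decomposition: ∑_{k=1}^{N−1} α_k = I, α_i α_j = δ_{ij} α_i, and every α_k
belongs to Γ (with D = N and S = S_N). -/
theorem stmt_17 {K : Type*} [Field K] (N : ℕ) (hN : 3 ≤ N) :
    (∑ k ∈ Finset.Icc 1 (N - 1), alphaFull K N k = 1) ∧
    (∀ i ∈ Finset.Icc 1 (N - 1), ∀ j ∈ Finset.Icc 1 (N - 1),
      alphaFull K N i * alphaFull K N j = if i = j then alphaFull K N i else 0) ∧
    (∀ k ∈ Finset.Icc 1 (N - 1), alphaFull K N k ∈ GammaSet N (SN K N)) := by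
  have hcase : ∀ k ∈ Finset.Icc 1 (N - 1), k = 1 ∨ (k ≠ 1 ∧ k ∈ Finset.Icc 2 (N - 1)) := by
    intro k hk
    simp only [Finset.mem_Icc] at hk ⊢
    omega
  have hone : alphaFull K N 1 = 1 - ∑ j ∈ Finset.Icc 2 (N - 1), alphaPoly K N j := if_pos rfl
  have hne : ∀ k, k ≠ 1 → alphaFull K N k = alphaPoly K N k := fun k hk => if_neg hk
  have hleft : ∀ k ∈ Finset.Icc 2 (N - 1),
      alphaPoly K N k * ∑ j ∈ Finset.Icc 2 (N - 1), alphaPoly K N j = alphaPoly K N k := by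
    intro k hk
    rw [Finset.mul_sum, Finset.sum_congr rfl fun j hj => alphaPoly_mul_alphaPoly K hk hj,
      Finset.sum_ite_eq, if_pos hk]
  have hright : ∀ k ∈ Finset.Icc 2 (N - 1),
      (∑ j ∈ Finset.Icc 2 (N - 1), alphaPoly K N j) * alphaPoly K N k = alphaPoly K N k := by
    intro k hk
    rw [Finset.sum_mul, Finset.sum_eq_single_of_mem k hk, alphaPoly_mul_alphaPoly K hk hk,
      if_pos rfl]
    intro j hj hjk
    rw [alphaPoly_mul_alphaPoly K hj hk, if_neg hjk]
  refine ⟨?_, fun i hi j hj => ?_, fun k hk => ?_⟩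
  · rw [← Finset.add_sum_Ioc_eq_sum_Icc (by omega : 1 ≤ N - 1), hone, sub_add,
      sub_eq_self, sub_eq_zero]
    refine Finset.sum_congr rfl fun k hk => (hne k ?_).symm
    have := (Finset.mem_Icc.1 hk).1
    omega
  · rcases hcase i hi with rfl | ⟨hi1, hi2⟩ <;> rcases hcase j hj with rfl | ⟨hj1, hj2⟩
    · rw [if_pos rfl, hone, sub_mul, one_mul, sub_eq_self, mul_sub, mul_one, sub_eq_zero,
        Finset.sum_mul]
      exact (Finset.sum_congr rfl hleft).symm
    · rw [if_neg hj1.symm, hone, hne j hj1, sub_mul, one_mul, hright j hj2, sub_self]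
    · rw [if_neg hi1, hone, hne i hi1, mul_sub, mul_one, hleft i hi2, sub_self]
    · rw [hne i hi1, hne j hj1, alphaPoly_mul_alphaPoly K hi2 hj2]
  · rcases hcase k hk with rfl | ⟨hk1, hk2⟩
    · rw [hone]
      refine sub_sum_mem_GammaSet (one_mem_GammaSet (SN_pow_eq_zero K le_rfl)) fun j hj => ?_
      simp only [Finset.mem_Icc] at hj
      exact alphaPoly_mem_GammaSet K hj.1 hj.2
    · simp only [Finset.mem_Icc] at hk2
      rw [hne k hk1]
      exact alphaPoly_mem_GammaSet K hk2.1 hk2.2
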